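/- (Theorem 3: Conway circles for even tangential polygons.) Let n ≥ 4 be even and let V₁, …, Vₙ (indexed cyclically) be the vertices of a convex tangential polygon with incenter I, inradius r > 0, and side lengths h_i = dist V_i V_{i+1} (indices mod n, so h_n = dist V_n V₁). Let h₀ = dist V₁ T, where T is the orthogonal projection of I onto the line through V_n and V₁ (the tangency point of the incircle on side V_n V₁). For each k ∈ {1, …, n} define E_k = Σ{h_i : 1 ≤ i < k, i odd} + Σ{h_i : k < i ≤ n, i even} - h₀ if k is odd, and E_k = Σ{h_i : 1 ≤ i < k, i even} + Σ{h_i : k < i ≤ n, i odd} + h₀ if k is even. For each k form the two points obtained by extending both sides through V_k beyond V_k by signed length E_k: the point V_k + (E_k / h_k) • (V_k - V_{k+1}) and the point V_k + (E_k / h_{k-1}) • (V_k - V_{k-1}). Then all 2n resulting points are equidistant from I, i.e., they lie on a common circle centered at the polygon's incenter. -/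

import Mathlib

noncomputable section

/-- The Euclidean plane. -/
abbrev Pt : Type := EuclideanSpace ℝ (Fin 2)

/-- A point of a line at minimal distance from `I` is a foot of the perpendicular from `I`. -/
lemma inner_eq_zero_of_dist_eq_infDist {A B I T : Pt}
    (hT : T ∈ affineSpan ℝ ({A, B} : Set Pt))
    (hd : Metric.infDist I (affineSpan ℝ {A, B} : Set Pt) = dist I T) :
    inner ℝ (I - T) (A - B) = 0 := by
  have hle : ∀ s : ℝ, ‖I - T‖ ^ 2 ≤ ‖(I - T) - s • (A - B)‖ ^ 2 := by
    intro s
    have hmem : s • (A - B) + T ∈ affineSpan ℝ ({A, B} : Set Pt) := by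
      have hdir : s • (A - B) ∈ (affineSpan ℝ ({A, B} : Set Pt)).direction :=
        Submodule.smul_mem _ _ (AffineSubspace.vsub_mem_direction
          (left_mem_affineSpan_pair ℝ A B) (right_mem_affineSpan_pair ℝ A B))
      exact AffineSubspace.vadd_mem_of_mem_direction hdir hT
    have h := Metric.infDist_le_dist_of_mem (x := I) hmem
    rw [hd, dist_eq_norm, dist_eq_norm] at h
    have e : I - T - s • (A - B) = I - (s • (A - B) + T) := by abel
    rw [e]
    gcongr
  have hexp : ∀ s : ℝ,
      0 ≤ s ^ 2 * ‖A - B‖ ^ 2 - 2 * (s * inner ℝ (I - T) (A - B)) := by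
    intro s
    have h := hle s
    rw [norm_sub_sq_real (I - T), inner_smul_right, norm_smul, mul_pow, Real.norm_eq_abs, sq_abs] at h
    linarith
  by_cases hAB : A - B = 0
  · simp [hAB]
  have hpos : 0 < ‖A - B‖ ^ 2 := by positivity
  have h := hexp (inner ℝ (I - T) (A - B) / ‖A - B‖ ^ 2)
  have e : (inner ℝ (I - T) (A - B) / ‖A - B‖ ^ 2) ^ 2 * ‖A - B‖ ^ 2
      - 2 * (inner ℝ (I - T) (A - B) / ‖A - B‖ ^ 2 * inner ℝ (I - T) (A - B))
      = -(inner ℝ (I - T) (A - B) ^ 2 / ‖A - B‖ ^ 2) := by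
    field_simp
    ring
  rw [e] at h
  have hz : inner ℝ (I - T) (A - B) ^ 2 / ‖A - B‖ ^ 2 = 0 :=
    le_antisymm (by linarith) (by positivity)
  simpa [hpos.ne'] using hz

/-- Pythagoras for a point `I`, its foot `T` on the line `AB`, and the endpoint `A`. -/
lemma dist_sq_eq_add_of_dist_eq_infDist {A B I T : Pt}
    (hT : T ∈ affineSpan ℝ ({A, B} : Set Pt))
    (hd : Metric.infDist I (affineSpan ℝ {A, B} : Set Pt) = dist I T) :
    dist I A ^ 2 = dist I T ^ 2 + dist A T ^ 2 := by
  have h0 := inner_eq_zero_of_dist_eq_infDist hT hd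
  obtain ⟨s, rfl⟩ := mem_affineSpan_pair_iff_exists_lineMap_eq.1 hT
  set T := AffineMap.lineMap A B s with hTdef
  have e : T - A = -(s • (A - B)) := by
    rw [hTdef, AffineMap.lineMap_apply, vsub_eq_sub, vadd_eq_add, ← smul_neg, neg_sub]
    abel
  rw [dist_comm A T, dist_eq_norm, dist_eq_norm, dist_eq_norm,
    ← sub_add_sub_cancel I T A, norm_add_sq_real, e, inner_neg_right, inner_smul_right, h0]
  ring

/-- Extending the side `BA` beyond `A` by `x` gives a point at signed distance `x + dist A T`
from the tangency point `T`. -/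
lemma dist_sq_extend {A B I T : Pt} (hT : Sbtw ℝ A T B)
    (hd : Metric.infDist I (affineSpan ℝ {A, B} : Set Pt) = dist I T) (x : ℝ) :
    dist I (A + (x / dist A B) • (A - B)) ^ 2 = dist I T ^ 2 + (x + dist A T) ^ 2 := by
  have hAB : dist A B ≠ 0 := dist_ne_zero.2 hT.left_ne_right
  have h0 := inner_eq_zero_of_dist_eq_infDist hT.wbtw.mem_affineSpan hd
  obtain ⟨s, hs, rfl⟩ := hT.wbtw
  rw [dist_left_lineMap, Real.norm_eq_abs, abs_of_nonneg hs.1]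
  set T := AffineMap.lineMap A B s with hTdef
  have e : I - (A + (x / dist A B) • (A - B)) = (I - T) - (x / dist A B + s) • (A - B) := by
    have : T = A - s • (A - B) := by
      rw [hTdef, AffineMap.lineMap_apply, vsub_eq_sub, vadd_eq_add, ← neg_sub A B, smul_neg]
      abel
    rw [this, add_smul]
    abel
  rw [dist_eq_norm I (A + _), e, norm_sub_sq_real, inner_smul_right, h0, norm_smul, mul_pow,
    Real.norm_eq_abs, sq_abs, ← dist_eq_norm, ← dist_eq_norm]
  field_simp
  ring

lemma sum_Ico_add_two (f : ℕ → ℝ) {m : ℕ} (hm : 1 ≤ m) :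
    ∑ i ∈ Finset.Ico 1 (m + 1 + 1), f i = ∑ i ∈ Finset.Ico 1 m, f i + f m + f (m + 1) := by
  rw [Finset.sum_Ico_succ_top (by omega), Finset.sum_Ico_succ_top hm]

lemma sum_odd_Ico {h t : ℕ → ℝ} (hht : ∀ i, h i = t i + t (i + 1)) (j : ℕ) :
    ∑ i ∈ (Finset.Ico 1 (2 * j + 1)).filter (fun i => Odd i), h i =
      ∑ i ∈ Finset.Ico 1 (2 * j + 1), t i := by
  simp only [Finset.sum_filter]
  induction j with
  | zero => simp
  | succ j ih =>
    rw [show 2 * (j + 1) + 1 = 2 * j + 1 + 1 + 1 by ring]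
    simp only [sum_Ico_add_two _ (show 1 ≤ 2 * j + 1 by omega)]
    rw [ih, if_pos (by grind), if_neg (by grind), hht]
    ring

lemma sum_even_Ico {h t : ℕ → ℝ} (hht : ∀ i, h i = t i + t (i + 1)) (j : ℕ) :
    ∑ i ∈ (Finset.Ico 1 (2 * j + 2)).filter (fun i => Even i), h i + t 1 =
      ∑ i ∈ Finset.Ico 1 (2 * j + 2), t i := by
  simp only [Finset.sum_filter]
  induction j with
  | zero => simp
  | succ j ih =>
    rw [show 2 * (j + 1) + 2 = 2 * j + 2 + 1 + 1 by ring]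
    simp only [sum_Ico_add_two _ (show 1 ≤ 2 * j + 2 by omega)]
    rw [← ih, if_pos (by grind), if_neg (by grind), hht]
    ring

lemma sum_filter_Ioc_eq_sub (h : ℕ → ℝ) (p : ℕ → Prop) [DecidablePred p] {k n : ℕ}
    (hkn : k ≤ n) :
    ∑ i ∈ (Finset.Ioc k n).filter p, h i =
      ∑ i ∈ (Finset.Ico 1 (n + 1)).filter p, h i -
        ∑ i ∈ (Finset.Ico 1 (k + 1)).filter p, h i := by
  have e : Finset.Ioc k n = Finset.Ico (k + 1) (n + 1) := by
    ext; simp only [Finset.mem_Ioc, Finset.mem_Ico]; omega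
  simp only [Finset.sum_filter, e]
  rw [← Finset.sum_Ico_consecutive _ (show 1 ≤ k + 1 by omega) (show k + 1 ≤ n + 1 by omega)]
  ring

/-- If each `h i` splits as `t i + t (i + 1)` with `t` closing up after an even number `n` of
steps, the alternating-parity sums of `h` become `∑ t` after adding `t k`. -/
lemma alternating_sum_add_eq {h t : ℕ → ℝ} (hht : ∀ i, h i = t i + t (i + 1)) {n : ℕ}
    (hn : Even n) (ht : t (n + 1) = t 1) {k : ℕ} (hk : 1 ≤ k) (hkn : k ≤ n) :
    (if Odd k then
        (∑ i ∈ (Finset.Ico 1 k).filter (fun i => Odd i), h i) +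
          (∑ i ∈ (Finset.Ioc k n).filter (fun i => Even i), h i) - t 1
      else
        (∑ i ∈ (Finset.Ico 1 k).filter (fun i => Even i), h i) +
          (∑ i ∈ (Finset.Ioc k n).filter (fun i => Odd i), h i) + t 1) + t k =
      ∑ i ∈ Finset.Ico 1 (n + 1), t i := by
  have hsucc : ∑ i ∈ Finset.Ico 1 (k + 1), t i = ∑ i ∈ Finset.Ico 1 k, t i + t k :=
    Finset.sum_Ico_succ_top hk _
  rw [sum_filter_Ioc_eq_sub h _ hkn, sum_filter_Ioc_eq_sub h _ hkn]
  obtain ⟨m, rfl⟩ := hn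
  split_ifs with hodd
  · obtain ⟨j, rfl⟩ := hodd
    have h1 := sum_odd_Ico hht j
    have h2 := sum_even_Ico hht j
    have h3 := sum_even_Ico hht m
    rw [← two_mul] at ht ⊢
    have h4 : ∑ i ∈ (Finset.Ico 1 (2 * m + 2)).filter (fun i => Even i), h i =
        ∑ i ∈ (Finset.Ico 1 (2 * m + 1)).filter (fun i => Even i), h i := by
      simp only [Finset.sum_filter]
      rw [Finset.sum_Ico_succ_top (by omega), if_neg (by grind), add_zero]
    rw [h4, Finset.sum_Ico_succ_top (by omega), ht] at h3
    linarith
  · obtain ⟨j, rfl⟩ : ∃ j, k = 2 * j + 2 := by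
      obtain ⟨a, ha⟩ := Nat.not_odd_iff_even.1 hodd
      exact ⟨a - 1, by omega⟩
    have h1 := sum_even_Ico hht j
    have h2 := sum_odd_Ico hht (j + 1)
    have h3 := sum_odd_Ico hht m
    rw [← two_mul]
    rw [show 2 * (j + 1) + 1 = 2 * j + 2 + 1 by ring] at h2
    linarith

/-- **Theorem 3: Conway circles for even tangential polygons.**
For an even convex tangential polygon `V₁, …, Vₙ` (indexed cyclically via
`ZMod n`) with incenter `I`, inradius `r`, side lengths `h i`, and `h₀` the
distance from `V₁` to the tangency point `T` of the incircle on the side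
`Vₙ V₁`, extending both sides through the `k`-th vertex by the signed length
`E k` (an alternating-parity sum of side lengths, corrected by `∓ h₀`)
produces `2n` points equidistant from `I`. -/
theorem conway_circles_even_polygon
    (n : ℕ) (hn : 4 ≤ n) (hneven : Even n)
    (V : ZMod n → Pt) (I : Pt) (r : ℝ) (hr : 0 < r)
    (hne : ∀ i : ZMod n, V i ≠ V (i + 1))
    (htangent : ∀ i : ZMod n, ∃ T : Pt, Sbtw ℝ (V i) T (V (i + 1)) ∧ dist I T = r ∧
      Metric.infDist I (affineSpan ℝ {V i, V (i + 1)} : Set Pt) = r)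
    (hconvex : ∀ i j : ZMod n, j ≠ i → j ≠ i + 1 →
      (affineSpan ℝ {V i, V (i + 1)}).SSameSide I (V j))
    (h : ℕ → ℝ)
    (hh : ∀ i : ℕ, h i = dist (V (i : ZMod n)) (V ((i : ZMod n) + 1)))
    (T : Pt)
    (hT : T ∈ affineSpan ℝ ({V (n : ZMod n), V ((n : ZMod n) + 1)} : Set Pt))
    (hTr : dist I T = r)
    (h0 : ℝ) (hh0 : h0 = dist (V ((n : ZMod n) + 1)) T)
    (E : ℕ → ℝ)
    (hE : ∀ k : ℕ, E k =
      if Odd k then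
        (∑ i ∈ (Finset.Ico 1 k).filter (fun i => Odd i), h i) +
          (∑ i ∈ (Finset.Ioc k n).filter (fun i => Even i), h i) - h0
      else
        (∑ i ∈ (Finset.Ico 1 k).filter (fun i => Even i), h i) +
          (∑ i ∈ (Finset.Ioc k n).filter (fun i => Odd i), h i) + h0) :
    ∃ ρ : ℝ, ∀ k : ℕ, 1 ≤ k → k ≤ n →
      dist I (V (k : ZMod n) +
        (E k / h k) • (V (k : ZMod n) - V ((k : ZMod n) + 1))) = ρ ∧
      dist I (V (k : ZMod n) +
        (E k / h (k - 1)) • (V (k : ZMod n) - V ((k : ZMod n) - 1))) = ρ := by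
  choose S hS hSr hSd using htangent
  have hd : ∀ i, Metric.infDist I (affineSpan ℝ {V i, V (i + 1)} : Set Pt) = dist I (S i) :=
    fun i => (hSd i).trans (hSr i).symm
  have hd' : ∀ i, Metric.infDist I (affineSpan ℝ {V (i + 1), V i} : Set Pt) = dist I (S i) :=
    fun i => by rw [Set.pair_comm]; exact hd i
  have hleft : ∀ i, dist I (V i) ^ 2 = r ^ 2 + dist (V i) (S i) ^ 2 := fun i => by
    rw [dist_sq_eq_add_of_dist_eq_infDist (hS i).wbtw.mem_affineSpan (hd i), hSr]
  have hright : ∀ i, dist I (V (i + 1)) ^ 2 = r ^ 2 + dist (V (i + 1)) (S i) ^ 2 := fun i => by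
    rw [dist_sq_eq_add_of_dist_eq_infDist (hS i).symm.wbtw.mem_affineSpan (hd' i), hSr]
  have htan : ∀ i, dist (V (i + 1)) (S i) = dist (V (i + 1)) (S (i + 1)) := fun i =>
    (sq_eq_sq₀ dist_nonneg dist_nonneg).1 (by linarith [hleft (i + 1), hright i])
  have hT0 : h0 = dist (V ((n : ZMod n) + 1)) (S ((n : ZMod n) + 1)) := by
    have hTd := dist_sq_eq_add_of_dist_eq_infDist (Set.pair_comm (V n) (V (n + 1)) ▸ hT)
      ((hd' n).trans ((hSr n).trans hTr.symm))
    rw [hTr] at hTd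
    rw [hh0]
    exact (sq_eq_sq₀ dist_nonneg dist_nonneg).1 (by linarith [hleft (n + 1)])
  set t : ℕ → ℝ := fun i => dist (V (i : ZMod n)) (S (i : ZMod n)) with ht
  have hht : ∀ i, h i = t i + t (i + 1) := by
    intro i
    simp only [ht, Nat.cast_add, Nat.cast_one]
    rw [hh, ← htan, dist_comm (V (_ + 1)) (S _)]
    exact (hS i).wbtw.dist_add_dist.symm
  have ht1 : h0 = t 1 := by simpa [ht] using hT0
  have hE' : ∀ k, 1 ≤ k → k ≤ n → E k + t k = ∑ i ∈ Finset.Ico 1 (n + 1), t i := by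
    intro k hk hkn
    rw [hE, ht1]
    exact alternating_sum_add_eq hht hneven (by simp [ht]) hk hkn
  refine ⟨√(r ^ 2 + (∑ i ∈ Finset.Ico 1 (n + 1), t i) ^ 2), fun k hk hkn => ⟨?_, ?_⟩⟩
  · rw [← hE' k hk hkn, hh, ← hSr k, ← dist_sq_extend (hS k) (hd k), Real.sqrt_sq dist_nonneg]
  · obtain ⟨m, rfl⟩ := Nat.exists_eq_add_of_le' hk
    have hm := htan m
    rw [← hE' _ hk hkn, hh, Nat.add_sub_cancel]
    simp only [ht, Nat.cast_add, Nat.cast_one, add_sub_cancel_right]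
    rw [← hm, ← hSr m, dist_comm (V m), ← dist_sq_extend (hS m).symm (hd' m),
      Real.sqrt_sq dist_nonneg]
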